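/- Let G be an (n,d,λ)-graph with λ < αd/10¹⁰, d ≥ n^α, and n sufficiently large, for a constant α ∈ (0,1). Then G contains at least αn/8 vertex-disjoint cycles each of length at most 4/α. -/

import Mathlib

open Finset

open Classical in
def IsNDLGraph (n d : ℕ) (lam : ℝ) (G : SimpleGraph (Fin n)) : Prop :=
  G.IsRegularOfDegree d ∧ 0 ≤ lam ∧
    ∀ μ : ℝ, Module.End.HasEigenvalue (Matrix.toLin' (G.adjMatrix ℝ)) μ → μ = (d : ℝ) ∨ |μ| ≤ lam

/-- Two distinct paths between the same vertices create a cycle whose length is at most the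
sum of their lengths. -/
lemma exists_isCycle_of_path_ne {V : Type*} {G : SimpleGraph V} {u v : V} {p q : G.Walk u v}
    (hp : p.IsPath) (hq : q.IsPath) (hne : p ≠ q) :
    ∃ (w : V) (c : G.Walk w w), c.IsCycle ∧ c.length ≤ p.length + q.length := by
  classical
  let K : SimpleGraph V := SimpleGraph.fromEdgeSet {e | e ∈ p.edges ++ q.edges}
  have hKG : K ≤ G := by
    intro a b hab
    have hab' := ((SimpleGraph.fromEdgeSet_adj _).1 hab).1
    simp only [Set.mem_ofPred_eq, List.mem_append] at hab'
    exact hab'.elim p.adj_of_mem_edges q.adj_of_mem_edges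
  have hpK : ∀ e ∈ p.edges, e ∈ K.edgeSet := by
    intro e he
    rw [SimpleGraph.edgeSet_fromEdgeSet]
    exact ⟨List.mem_append_left _ he, G.not_isDiag_of_mem_edgeSet (p.edges_subset_edgeSet he)⟩
  have hqK : ∀ e ∈ q.edges, e ∈ K.edgeSet := by
    intro e he
    rw [SimpleGraph.edgeSet_fromEdgeSet]
    exact ⟨List.mem_append_right _ he, G.not_isDiag_of_mem_edgeSet (q.edges_subset_edgeSet he)⟩
  have hK : ¬ K.IsAcyclic := by
    intro hac
    have h := (hac.subsingleton_path u v).elim ⟨p.transfer K hpK, hp.transfer hpK⟩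
      ⟨q.transfer K hqK, hq.transfer hqK⟩
    have h' : p.transfer K hpK = q.transfer K hqK := congrArg Subtype.val h
    apply hne
    apply SimpleGraph.Walk.ext_support
    have := congrArg SimpleGraph.Walk.support h'
    simpa using this
  simp only [SimpleGraph.IsAcyclic, not_forall, not_not] at hK
  obtain ⟨w, c, hc⟩ := hK
  refine ⟨w, c.mapLe hKG, (SimpleGraph.Walk.isCycle_mapLe hKG).2 hc, ?_⟩
  have hsub : c.edges ⊆ p.edges ++ q.edges := by
    intro e he
    have := c.edges_subset_edgeSet he
    rw [SimpleGraph.edgeSet_fromEdgeSet] at this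
    exact this.1
  have := (hc.edges_nodup.subperm hsub).length_le
  simpa using this

/-- Moore bound: a graph of minimum degree at least `δ + 1` on the vertex set `S` without cycles of
length at most `2 * l` satisfies `δ ^ l ≤ #S`. -/
lemma pow_le_card_of_forall_isCycle {V : Type*} [DecidableEq V] (H : SimpleGraph V)
    [DecidableRel H.Adj] (S : Finset V) (hS : S.Nonempty) (δ l : ℕ)
    (hdeg : ∀ x ∈ S, δ + 1 ≤ #{y ∈ S | H.Adj x y})
    (hcyc : ∀ (w : V) (c : H.Walk w w), c.IsCycle → 2 * l < c.length) :
    δ ^ l ≤ #S := by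
  classical
  obtain ⟨v, hv⟩ := hS
  have huniq : ∀ (a b : V) (p q : H.Walk a b), p.IsPath → q.IsPath → p.length ≤ l →
      q.length ≤ l → p = q := by
    intro a b p q hp hq hpl hql
    by_contra hne
    obtain ⟨w, c, hc, hcl⟩ := exists_isCycle_of_path_ne hp hq hne
    have := hcyc w c hc
    omega
  have key : ∀ k ≤ l, ∃ T ⊆ S, (∀ x ∈ T, ∃ p : H.Walk v x, p.IsPath ∧ p.length = k) ∧
      δ ^ k ≤ #T := by
    intro k
    induction k with
    | zero =>
      intro _
      refine ⟨{v}, by simpa using hv, ?_, by simp⟩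
      intro x hx
      obtain rfl := Finset.mem_singleton.1 hx
      exact ⟨.nil, by simp, rfl⟩
    | succ k ih =>
      intro hk
      obtain ⟨T, hTS, hT, hcard⟩ := ih (by omega)
      let N : V → Finset V := fun x =>
        {y ∈ S | ∃ (p : H.Walk v x) (h : H.Adj x y), (p.concat h).IsPath ∧ p.length = k}
      refine ⟨T.biUnion N, ?_, ?_, ?_⟩
      · intro y hy
        obtain ⟨x, hx, hy⟩ := Finset.mem_biUnion.1 hy
        exact (Finset.mem_filter.1 hy).1
      · intro y hy
        obtain ⟨x, hx, hy⟩ := Finset.mem_biUnion.1 hy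
        obtain ⟨p, h, hp, hpl⟩ := (Finset.mem_filter.1 hy).2
        exact ⟨_, hp, by simp [hpl]⟩
      · rw [Finset.card_biUnion]
        · calc δ ^ (k + 1) = δ ^ k * δ := pow_succ _ _
            _ ≤ #T * δ := Nat.mul_le_mul_right _ hcard
            _ = ∑ x ∈ T, δ := by simp
            _ ≤ ∑ x ∈ T, #(N x) := by
              refine Finset.sum_le_sum fun x hx => ?_
              obtain ⟨p, hp, hpl⟩ := hT x hx
              have h1 := hdeg x (hTS hx)
              have h2 := Finset.pred_card_le_card_erase (s := {y ∈ S | H.Adj x y})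
                (a := p.penultimate)
              have h3 : {y ∈ S | H.Adj x y}.erase p.penultimate ⊆ N x := by
                intro y hy
                obtain ⟨hy1, hy2⟩ := Finset.mem_erase.1 hy
                obtain ⟨hyS, hxy⟩ := Finset.mem_filter.1 hy2
                refine Finset.mem_filter.2 ⟨hyS, p, hxy, hp.concat ?_ hxy, hpl⟩
                intro hmem
                apply hy1
                have h1 := huniq y x (p.dropUntil y hmem) (.cons hxy.symm .nil)
                  (hp.dropUntil hmem) (by simp [hxy.ne'])
                  ((p.length_dropUntil_le_length hmem).trans (by omega))
                  (by simp; omega)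
                have h2 := p.take_spec hmem
                rw [h1] at h2
                rw [← h2]
                exact (SimpleGraph.Walk.penultimate_concat _ hxy.symm).symm
              have h4 := Finset.card_le_card h3
              omega
        · intro x hx x' hx' hne
          refine Finset.disjoint_left.2 fun y hy hy' => hne ?_
          obtain ⟨p, h, hp, hpl⟩ := (Finset.mem_filter.1 hy).2
          obtain ⟨p', h', hp', hpl'⟩ := (Finset.mem_filter.1 hy').2
          have := huniq v y _ _ hp hp' (by simp; omega) (by simp; omega)
          exact (SimpleGraph.Walk.concat_inj this).1
  obtain ⟨T, hTS, -, hT⟩ := key l le_rfl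
  exact hT.trans (Finset.card_le_card hTS)

/-- A set spanning many edges contains a nonempty subset inducing large minimum degree. -/
lemma exists_subset_large_min_degree {V : Type*} [DecidableEq V] (G : SimpleGraph V)
    [DecidableRel G.Adj] (U : Finset V) (D : ℝ)
    (hU : D * #U < ∑ x ∈ U, (#{y ∈ U | G.Adj x y} : ℝ)) :
    ∃ S ⊆ U, S.Nonempty ∧ ∀ x ∈ S, D ≤ 2 * (#{y ∈ S | G.Adj x y} : ℝ) := by
  let f : Finset V → ℝ := fun S => ∑ x ∈ S, (#{y ∈ S | G.Adj x y} : ℝ) - D * #S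
  obtain ⟨S, hS, hmax⟩ := Finset.exists_max_image U.powerset f ⟨U, by simp⟩
  have hSU := Finset.mem_powerset.1 hS
  have hpos : 0 < f S := lt_of_lt_of_le (sub_pos.2 hU) (hmax U (by simp))
  refine ⟨S, hSU, ?_, ?_⟩
  · rw [Finset.nonempty_iff_ne_empty]
    rintro rfl
    simp [f] at hpos
  · intro x hx
    have h := hmax (S.erase x) (Finset.mem_powerset.2 ((Finset.erase_subset _ _).trans hSU))
    have hc : (#(S.erase x) : ℝ) = #S - 1 := by
      rw [Finset.card_erase_of_mem hx, Nat.cast_sub (Finset.card_pos.2 ⟨x, hx⟩)]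
      simp
    have hs : ∀ z, (#{y ∈ S | G.Adj z y} : ℝ) = ∑ y ∈ S, if G.Adj z y then (1 : ℝ) else 0 := by
      intro z; simp
    have hs' : ∀ z, (#{y ∈ S.erase x | G.Adj z y} : ℝ) =
        #{y ∈ S | G.Adj z y} - if G.Adj z x then (1 : ℝ) else 0 := by
      intro z
      rw [hs, ← Finset.add_sum_erase S _ hx]
      simp
    have e1 : ∑ z ∈ S.erase x, (#{y ∈ S.erase x | G.Adj z y} : ℝ) =
        ∑ z ∈ S, (#{y ∈ S | G.Adj z y} : ℝ) - 2 * #{y ∈ S | G.Adj x y} := by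
      have e2 : ∑ z ∈ S, (if G.Adj z x then (1 : ℝ) else 0) = #{y ∈ S | G.Adj x y} := by
        rw [hs]
        exact Finset.sum_congr rfl fun z _ => by simp [G.adj_comm]
      have e3 := Finset.add_sum_erase S (fun z => (#{y ∈ S.erase x | G.Adj z y} : ℝ)) hx
      have e4 : ∑ z ∈ S, (#{y ∈ S.erase x | G.Adj z y} : ℝ) =
          ∑ z ∈ S, (#{y ∈ S | G.Adj z y} : ℝ) - #{y ∈ S | G.Adj x y} := by
        rw [← e2, ← Finset.sum_sub_distrib]
        exact Finset.sum_congr rfl fun z _ => hs' z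
      have e5 := hs' x
      simp only [G.irrefl, if_false, sub_zero] at e5
      linarith
    simp only [f] at h
    rw [e1, hc] at h
    linarith

open Classical in
/-- Lower bound of the expander mixing lemma for the edges inside one vertex set. -/
lemma IsNDLGraph.le_sum_card_adj {n d : ℕ} {lam : ℝ} {G : SimpleGraph (Fin n)}
    (hG : IsNDLGraph n d lam G) (U : Finset (Fin n)) :
    d * (#U : ℝ) ^ 2 / n - lam * #U ≤ ∑ x ∈ U, (#{y ∈ U | G.Adj x y} : ℝ) := by
  obtain ⟨hreg, hlam, heig⟩ := hG
  rcases Nat.eq_zero_or_pos n with rfl | hn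
  · simp [Finset.eq_empty_of_isEmpty U]
  have hn' : (n : ℝ) ≠ 0 := by positivity
  set A := G.adjMatrix ℝ with hA
  have hAs : A.IsSymm := G.isSymm_adjMatrix
  have hB : (A + lam • (1 : Matrix (Fin n) (Fin n) ℝ)).IsHermitian := by
    rw [Matrix.IsHermitian, Matrix.conjTranspose_eq_transpose_of_trivial, Matrix.transpose_add,
      Matrix.transpose_smul, Matrix.transpose_one, hAs.eq]
  have hpsd : (A + lam • (1 : Matrix (Fin n) (Fin n) ℝ)).PosSemidef := by
    rw [hB.posSemidef_iff_eigenvalues_nonneg]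
    intro i
    have hv := hB.mulVec_eigenvectorBasis i
    rw [Matrix.add_mulVec, Matrix.smul_mulVec, Matrix.one_mulVec] at hv
    have hev : Module.End.HasEigenvalue (Matrix.toLin' A) (hB.eigenvalues i - lam) := by
      refine Module.End.hasEigenvalue_of_hasEigenvector (x := ⇑(hB.eigenvectorBasis i)) ⟨?_, ?_⟩
      · rw [Module.End.mem_eigenspace_iff, Matrix.toLin'_apply, sub_smul]
        exact eq_sub_of_add_eq hv
      · intro h0
        apply hB.eigenvectorBasis.orthonormal.ne_zero i
        ext j
        exact congrFun h0 j
    have hd : (0 : ℝ) ≤ d := Nat.cast_nonneg d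
    show 0 ≤ hB.eigenvalues i
    rcases heig _ hev with h | h
    · linarith
    · linarith [neg_le_of_abs_le h]
  set s : Fin n → ℝ := fun v => if v ∈ U then 1 else 0 with hs
  set o : Fin n → ℝ := fun _ => 1 with ho
  set c : ℝ := #U / n with hc
  have hpos := hpsd.dotProduct_mulVec_nonneg (s - c • o)
  have hAo : A.mulVec o = (d : ℝ) • o := by
    funext v
    have := SimpleGraph.adjMatrix_mulVec_const_apply_of_regular (α := ℝ) (a := 1) hreg (v := v)
    exact this.trans (by simp [ho])
  have hso : s ⬝ᵥ o = #U := by simp [dotProduct, hs, ho]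
  have hss : s ⬝ᵥ s = #U := by simp [dotProduct, hs]
  have hoo : o ⬝ᵥ o = n := by simp [dotProduct, ho]
  have hoAs : o ⬝ᵥ A.mulVec s = d * #U := by
    rw [Matrix.dotProduct_mulVec, ← Matrix.mulVec_transpose, hAs.eq, hAo, smul_dotProduct,
      dotProduct_comm, hso, smul_eq_mul]
  have hsAs : s ⬝ᵥ A.mulVec s = ∑ x ∈ U, (#{y ∈ U | G.Adj x y} : ℝ) := by
    have : ∀ x, A.mulVec s x = #{y ∈ U | G.Adj x y} := by
      intro x
      rw [hA, SimpleGraph.adjMatrix_mulVec_apply]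
      simp only [hs, Finset.sum_boole]
      congr 2
      ext y
      simp [and_comm]
    simp only [dotProduct, this]
    simp [hs]
  have hos : o ⬝ᵥ s = #U := by rw [dotProduct_comm, hso]
  simp only [star_trivial, Matrix.add_mulVec, Matrix.smul_mulVec, Matrix.one_mulVec,
    Matrix.mulVec_sub, Matrix.mulVec_smul, hAo, sub_dotProduct, dotProduct_sub, dotProduct_add,
    smul_dotProduct, dotProduct_smul, hso, hss, hoo, hoAs, hsAs, hos, smul_eq_mul] at hpos
  have hcn : c * n = #U := by rw [hc]; field_simp
  have h1 : (d : ℝ) * (#U : ℝ) ^ 2 / n = c * d * #U := by rw [hc]; ring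
  have h2 : 0 ≤ lam * (c * #U) := by positivity
  have h3 : c * (c * n) = c * #U := by rw [hcn]
  have h4 : c * (c * (d * n)) = c * d * #U := by rw [← hcn]; ring
  rw [h1]
  nlinarith [h2, h3, h4, hpos]

/-- A vertex set spanning large average degree contains a short cycle, written as a vertex list. -/
lemma exists_short_cycle_list {V : Type*} [DecidableEq V] (G : SimpleGraph V)
    [DecidableRel G.Adj] (U : Finset V) (δ l : ℕ)
    (hU : (2 * δ + 1 : ℝ) * #U < ∑ x ∈ U, (#{y ∈ U | G.Adj x y} : ℝ)) (hδ : #U < δ ^ l) :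
    ∃ c : List V, (∀ v ∈ c, v ∈ U) ∧ c.Nodup ∧ c.IsChain G.Adj ∧
      (∃ h : c ≠ [], G.Adj (c.getLast h) (c.head h)) ∧ 3 ≤ c.length ∧ c.length ≤ 2 * l := by
  classical
  obtain ⟨S, hSU, hSne, hS⟩ := exists_subset_large_min_degree G U _ hU
  let H : SimpleGraph V :=
    { Adj := fun x y => G.Adj x y ∧ x ∈ S ∧ y ∈ S
      symm := ⟨fun x y h => ⟨h.1.symm, h.2.2, h.2.1⟩⟩
      loopless := ⟨fun x h => G.irrefl h.1⟩ }
  have hsupp : ∀ {u v : V} (p : H.Walk u v), u ∈ S → ∀ w ∈ p.support, w ∈ S := by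
    intro u v p
    induction p with
    | nil => intro h w hw; simp at hw; exact hw ▸ h
    | cons h p ih =>
      intro hu w hw
      rcases List.mem_cons.1 hw with rfl | hw
      · exact hu
      · exact ih h.2.2 w hw
  have hcyc : ∃ (w : V) (c : H.Walk w w), c.IsCycle ∧ c.length ≤ 2 * l := by
    by_contra! hcon
    have := pow_le_card_of_forall_isCycle H S hSne δ l (fun x hx => by
      have h1 := hS x hx
      have h2 : {y ∈ S | H.Adj x y} = {y ∈ S | G.Adj x y} :=
        Finset.filter_congr fun y hy => ⟨fun h => h.1, fun h => ⟨h, hx, hy⟩⟩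
      rw [h2]
      have h3 : 2 * δ + 1 ≤ 2 * #{y ∈ S | G.Adj x y} := by exact_mod_cast h1
      omega) hcon
    exact absurd (this.trans (Finset.card_le_card hSU)) (by omega)
  obtain ⟨w, c, hc, hcl⟩ := hcyc
  cases c with
  | nil => exact absurd hc (by simp)
  | cons h p =>
    have hnd := hc.support_nodup
    have h3 := hc.three_le_length
    simp only [SimpleGraph.Walk.support_cons, List.tail_cons, SimpleGraph.Walk.length_cons]
      at hnd h3 hcl
    refine ⟨p.support, fun v hv => hSU (hsupp p h.2.2 v hv), hnd,
      p.isChain_adj_support.imp fun _ _ h => h.1, ⟨p.support_ne_nil, ?_⟩, ?_, ?_⟩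
    · rw [p.getLast_support, p.head_support]
      exact h.1
    · simpa using h3
    · simpa using hcl

theorem many_short_disjoint_cycles (α : ℝ) (hα0 : 0 < α) (hα1 : α < 1) :
    ∃ N : ℕ, ∀ n ≥ N, ∀ (d : ℕ) (lam : ℝ) (G : SimpleGraph (Fin n)),
      IsNDLGraph n d lam G → lam < α * d / 10 ^ 10 → (n : ℝ) ^ α ≤ (d : ℝ) →
      ∃ Cs : List (List (Fin n)),
        α * n / 8 ≤ (Cs.length : ℝ) ∧
        Cs.Pairwise (fun c c' => ∀ v ∈ c, v ∉ c') ∧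
        ∀ c ∈ Cs, c.Nodup ∧ c.Chain' G.Adj ∧
          (∃ h : c ≠ [], G.Adj (c.getLast h) (c.head h)) ∧
          3 ≤ c.length ∧ (c.length : ℝ) ≤ 4 / α := by
  classical
  set l : ℕ := ⌊2 / α⌋₊ with hl
  have hl2 : (l : ℝ) ≤ 2 / α := Nat.floor_le (by positivity)
  have hl1 : 1 < α * l := by
    have h1 : 2 / α < l + 1 := Nat.lt_floor_add_one _
    rw [div_lt_iff₀ hα0] at h1
    nlinarith
  have ht1 := (tendsto_rpow_atTop hα0).comp (tendsto_natCast_atTop_atTop (R := ℝ))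
  have ht2 := (tendsto_rpow_atTop (sub_pos.2 hl1)).comp (tendsto_natCast_atTop_atTop (R := ℝ))
  obtain ⟨N, hN⟩ := Filter.eventually_atTop.1 ((ht1.eventually_ge_atTop 64).and
    ((ht2.eventually_gt_atTop (16 ^ l)).and (Filter.eventually_gt_atTop 0)))
  refine ⟨N, fun n hn d lam G hG hlam hd => ?_⟩
  obtain ⟨hn1, hn2, hn0⟩ := hN n hn
  simp only [Function.comp_apply] at hn1 hn2
  have hn0' : (0 : ℝ) < n := by exact_mod_cast hn0
  have hd64 : (64 : ℝ) ≤ d := hn1.trans hd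
  set δ : ℕ := ⌈(d : ℝ) / 16⌉₊ with hδ
  have hδ1 : (d : ℝ) / 16 ≤ δ := Nat.le_ceil _
  have hδ2 : (δ : ℝ) < d / 16 + 1 := Nat.ceil_lt_add_one (by positivity)
  have hδl : n < δ ^ l := by
    have h1 : (n : ℝ) ^ α / 16 ≤ δ := by linarith
    have h2 : ((n : ℝ) ^ α / 16) ^ l ≤ (δ : ℝ) ^ l := by gcongr
    rw [div_pow, ← Real.rpow_mul_natCast hn0'.le] at h2
    have h3 : (n : ℝ) ^ (α * l) = (n : ℝ) ^ (α * l - 1) * n := by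
      rw [Real.rpow_sub_one hn0'.ne']
      field_simp
    have h4 : (n : ℝ) < (n : ℝ) ^ (α * l) / 16 ^ l := by
      rw [lt_div_iff₀ (by positivity), h3]
      nlinarith
    exact_mod_cast h4.trans_le h2
  have key : ∀ k ≤ ⌈α * n / 8⌉₊, ∃ Cs : List (List (Fin n)), Cs.length = k ∧
      Cs.Pairwise (fun c c' => ∀ v ∈ c, v ∉ c') ∧
      ∀ c ∈ Cs, c.Nodup ∧ c.IsChain G.Adj ∧
        (∃ h : c ≠ [], G.Adj (c.getLast h) (c.head h)) ∧ 3 ≤ c.length ∧ c.length ≤ 2 * l := by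
    intro k
    induction k with
    | zero => exact fun _ => ⟨[], by simp⟩
    | succ k ih =>
      intro hk
      obtain ⟨Cs, hlen, hpw, hCs⟩ := ih (by omega)
      have hk' : (k : ℝ) < α * n / 8 := Nat.lt_ceil.1 hk
      set W : Finset (Fin n) := Cs.flatten.toFinset with hW
      have hWcard : #W ≤ k * (2 * l) := by
        refine (List.toFinset_card_le _).trans ?_
        rw [List.length_flatten, ← hlen]
        have := List.sum_le_card_nsmul (Cs.map List.length) (2 * l) (by
          intro x hx
          obtain ⟨c, hc, rfl⟩ := List.mem_map.1 hx
          exact (hCs c hc).2.2.2.2)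
        simpa using this
      have hWn : 2 * (#W : ℝ) ≤ n := by
        have h1 : (#W : ℝ) ≤ k * (2 * l) := by exact_mod_cast hWcard
        have h2 : (k : ℝ) * (2 * l) ≤ (α * n / 8) * (2 * (2 / α)) := by gcongr
        have h3 : (α * n / 8) * (2 * (2 / α)) = n / 2 := by field_simp; norm_num
        linarith
      have hUc : (#Wᶜ : ℝ) = n - #W := by
        rw [Finset.card_compl, Nat.cast_sub (Finset.card_le_univ _)]
        simp
      have hUn : (n : ℝ) ≤ 2 * #Wᶜ := by linarith
      have hmix := hG.le_sum_card_adj Wᶜ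
      obtain ⟨c, hcU, hc⟩ := exists_short_cycle_list G Wᶜ δ l (by
        refine lt_of_lt_of_le ?_ hmix
        have hUpos : (0 : ℝ) < #Wᶜ := by linarith
        have h1 : (d : ℝ) / 2 * #Wᶜ ≤ d * (#Wᶜ : ℝ) ^ 2 / n := by
          rw [le_div_iff₀ hn0']
          have : 0 ≤ (d : ℝ) * #Wᶜ := by positivity
          nlinarith
        have h2 : lam < d / 10 := by
          have : α * d ≤ d := by nlinarith
          linarith
        have h3 : (2 * δ + 1 : ℝ) < d / 2 - lam := by linarith
        nlinarith) ((Finset.card_le_univ _).trans_lt (by simpa using hδl))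
      refine ⟨c :: Cs, by simp [hlen], List.pairwise_cons.2 ⟨?_, hpw⟩, ?_⟩
      · intro c' hc' v hv hv'
        have := Finset.mem_compl.1 (hcU v hv)
        exact this (List.mem_toFinset.2 (List.mem_flatten.2 ⟨c', hc', hv'⟩))
      · intro c' hc'
        rcases List.mem_cons.1 hc' with rfl | h
        · exact hc
        · exact hCs c' h
  obtain ⟨Cs, hlen, hpw, hCs⟩ := key _ le_rfl
  refine ⟨Cs, hlen ▸ Nat.le_ceil _, hpw, fun c hc => ?_⟩
  obtain ⟨h1, h2, h3, h4, h5⟩ := hCs c hc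
  refine ⟨h1, h2, h3, h4, ?_⟩
  have h6 : (c.length : ℝ) ≤ 2 * l := by exact_mod_cast h5
  calc (c.length : ℝ) ≤ 2 * l := h6
    _ ≤ 2 * (2 / α) := by gcongr
    _ = 4 / α := by ring
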